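/- There exist η > 0, C > 0 and X₀ > 0 such that the following holds for every integer X ≥ X₀ and every real number α. Let L = ⌊X^{θ+η}⌋ and H = ⌊10·X^{1−γ+η}/γ⌋. Then for all reals M, N, U, V ≥ 1 with M ≤ X^{γ−1/2−θ−5η}, U ≤ L and V ≤ H, and all complex coefficients a_m (m ∼ M), c_l (l a nonzero integer with |l| ∼ U) and d_h (h a nonzero integer with |h| ∼ V) of modulus at most 1, one has |S₃*| ≤ C·X^{1−2η}, where S₃* = Σ_{m ∼ M} Σ_{n ∼ N, mn ∼ X} Σ_{|l| ∼ U} Σ_{|h| ∼ V} a_m·c_l·d_h·e(α·l·m·n + h·(mn)^γ), the sums running over positive integers m, n and nonzero integers l, h in the indicated ranges. -/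

import Mathlib

open Finset

noncomputable def e (z : ℝ) : ℂ := Complex.exp (2 * Real.pi * Complex.I * z)

noncomputable def nint (x : ℝ) : ℝ := |x - round x|

noncomputable def dyN (Y : ℝ) : Finset ℕ :=
  (Finset.range (⌈Y⌉₊ + 1)).filter fun m => Y/2 ≤ (m:ℝ) ∧ (m:ℝ) < Y

noncomputable def dyZ (Y : ℝ) : Finset ℤ :=
  (Finset.Icc (-(⌈Y⌉₊:ℤ)) (⌈Y⌉₊:ℤ)).filter fun l => l ≠ 0 ∧ Y/2 ≤ |(l:ℝ)| ∧ |(l:ℝ)| < Y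

lemma norm_e (z : ℝ) : ‖e z‖ = 1 := by
  have : (2 * Real.pi * Complex.I * z : ℂ) = ((2 * Real.pi * z : ℝ) : ℂ) * Complex.I := by
    push_cast; ring
  rw [e, this, Complex.norm_exp_ofReal_mul_I]

lemma e_add (y z : ℝ) : e (y + z) = e y * e z := by
  simp only [e, ← Complex.exp_add]
  congr 1
  push_cast
  ring

lemma e_neg (z : ℝ) : e (-z) = (starRingEnd ℂ) (e z) := by
  simp only [e, ← Complex.exp_conj]
  congr 1
  simp [Complex.conj_ofNat]

lemma norm_sum_e_neg {ι : Type*} (S : Finset ι) (x : ι → ℝ) :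
    ‖∑ n ∈ S, e (-x n)‖ = ‖∑ n ∈ S, e (x n)‖ := by
  simp only [e_neg, ← map_sum, RCLike.norm_conj]

lemma one_sub_e_mul_cot (t : ℝ) (ht : Real.sin (Real.pi * t) ≠ 0) :
    (1 - e t) * ((1 + (Real.cot (Real.pi * t) : ℂ) * Complex.I) / 2) = 1 := by
  set u := Real.pi * t with hu
  have he : e t = (Real.cos u + Real.sin u * Complex.I) ^ 2 := by
    have h2 : (2 * Real.pi * Complex.I * t : ℂ) = (2 : ℕ) * ((u : ℂ) * Complex.I) := by
      rw [hu]; push_cast; ring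
    rw [e, h2, Complex.exp_nat_mul, Complex.exp_mul_I, Complex.ofReal_cos, Complex.ofReal_sin]
  have hs : (Real.sin u : ℂ) ≠ 0 := by exact_mod_cast ht
  have hcs : (Real.sin u : ℂ) ^ 2 + (Real.cos u : ℂ) ^ 2 = 1 := by
    exact_mod_cast Real.sin_sq_add_cos_sq u
  have hI : Complex.I ^ 2 = -1 := Complex.I_sq
  rw [he, Real.cot_eq_cos_div_sin, Complex.ofReal_div]
  generalize (Real.sin u : ℂ) = s at *
  generalize (Real.cos u : ℂ) = r at *
  field_simp
  linear_combination (-s ^ 3 - 2 * r ^ 2 * s - r * s ^ 2 * Complex.I) * hI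
    + (s - r * Complex.I) * hcs

/-- Abel summation against a decreasing weight. -/
lemma norm_sum_sub_mul_antitone_le (E : ℕ → ℂ) (hE : ∀ n, ‖E n‖ ≤ 1) (g : ℕ → ℝ) (N : ℕ)
    (hg : ∀ n < N, g (n + 1) ≤ g n) :
    ‖∑ n ∈ range (N + 1), (E n - E (n + 1)) * (g n : ℂ) + E (N + 1) * (g N : ℂ)‖
      ≤ |g 0| + (g 0 - g N) := by
  induction N with
  | zero =>
    have : ‖E 0‖ * |g 0| ≤ |g 0| := mul_le_of_le_one_left (abs_nonneg _) (hE 0)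
    simpa [sub_mul] using this
  | succ N ih =>
    have ih' := ih fun n hn => hg n (by omega)
    have hstep : ‖E (N + 1) * ((g (N + 1) - g N : ℝ) : ℂ)‖ ≤ g N - g (N + 1) := by
      rw [norm_mul, Complex.norm_real, Real.norm_eq_abs,
        abs_of_nonpos (by linarith [hg N (by omega)])]
      nlinarith [hE (N + 1), hg N (by omega), norm_nonneg (E (N + 1))]
    rw [sum_range_succ]
    have heq : ∑ n ∈ range (N + 1), (E n - E (n + 1)) * (g n : ℂ)
          + (E (N + 1) - E (N + 1 + 1)) * (g (N + 1) : ℂ) + E (N + 1 + 1) * (g (N + 1) : ℂ)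
        = (∑ n ∈ range (N + 1), (E n - E (n + 1)) * (g n : ℂ) + E (N + 1) * (g N : ℂ))
          + E (N + 1) * ((g (N + 1) - g N : ℝ) : ℂ) := by
      push_cast; ring
    rw [heq]
    linarith [norm_add_le (∑ n ∈ range (N + 1), (E n - E (n + 1)) * (g n : ℂ)
      + E (N + 1) * (g N : ℂ)) (E (N + 1) * ((g (N + 1) - g N : ℝ) : ℂ))]

lemma Real.cot_le_cot_of_pos_of_lt_pi {a b : ℝ} (ha : 0 < a) (hab : a ≤ b) (hb : b < Real.pi) :
    Real.cot b ≤ Real.cot a := by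
  have hsa := Real.sin_pos_of_pos_of_lt_pi ha (by linarith)
  have hsb := Real.sin_pos_of_pos_of_lt_pi (by linarith : 0 < b) hb
  have h := Real.sin_nonneg_of_nonneg_of_le_pi (by linarith : 0 ≤ b - a) (by linarith)
  rw [Real.sin_sub] at h
  rw [Real.cot_eq_cos_div_sin, Real.cot_eq_cos_div_sin, div_le_div_iff₀ hsb hsa]
  linarith

lemma two_mul_le_sin_pi_mul {δ t : ℝ} (hδ : 0 < δ) (h1 : δ ≤ t) (h2 : t ≤ 1 - δ) :
    2 * δ ≤ Real.sin (Real.pi * t) := by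
  have hpi := Real.pi_pos
  have key : ∀ u, δ ≤ u → u ≤ 1 / 2 → 2 * δ ≤ Real.sin (Real.pi * u) := by
    intro u hu hu'
    have h := Real.mul_le_sin (x := Real.pi * u) (by nlinarith) (by nlinarith)
    have : 2 / Real.pi * (Real.pi * u) = 2 * u := by field_simp
    linarith
  rcases le_total t (1 / 2) with h | h
  · exact key t h1 h
  · rw [← Real.sin_pi_sub, show Real.pi - Real.pi * t = Real.pi * (1 - t) by ring]
    exact key (1 - t) (by linarith) (by linarith)

lemma abs_cot_pi_mul_le {δ t : ℝ} (hδ : 0 < δ) (h1 : δ ≤ t) (h2 : t ≤ 1 - δ) :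
    |Real.cot (Real.pi * t)| ≤ 1 / (2 * δ) := by
  have hs := two_mul_le_sin_pi_mul hδ h1 h2
  have hs0 : 0 < Real.sin (Real.pi * t) := by linarith
  rw [Real.cot_eq_cos_div_sin, abs_div, abs_of_pos hs0]
  exact div_le_div₀ zero_le_one (Real.abs_cos_le_one _) (by linarith) hs

/-- The Kusmin–Landau inequality. -/
lemma norm_sum_range_e_le_two_div (x : ℕ → ℝ) (N : ℕ) (k : ℤ) {δ : ℝ} (hδ : 0 < δ)
    (hlow : ∀ n < N, k + δ ≤ x (n + 1) - x n) (hupp : ∀ n < N, x (n + 1) - x n ≤ k + 1 - δ)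
    (hmono : ∀ n, n + 1 < N → x (n + 1) - x n ≤ x (n + 1 + 1) - x (n + 1)) :
    ‖∑ n ∈ range N, e (x n)‖ ≤ 2 / δ := by
  rcases N with _ | N
  · simp; positivity
  set d : ℕ → ℝ := fun n => x (n + 1) - x n - k with hd
  set g : ℕ → ℝ := fun n => Real.cot (Real.pi * d n) with hg
  have hd1 : ∀ n < N + 1, δ ≤ d n := fun n hn => by linarith [hlow n hn]
  have hd2 : ∀ n < N + 1, d n ≤ 1 - δ := fun n hn => by linarith [hupp n hn]
  have hk : e (-(k : ℝ)) = 1 := by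
    rw [e, Complex.exp_eq_one_iff]
    exact ⟨-k, by push_cast; ring⟩
  have hterm : ∀ n ∈ range (N + 1), e (x n)
      = 1 / 2 * (e (x n) - e (x (n + 1)))
        + Complex.I / 2 * ((e (x n) - e (x (n + 1))) * (g n : ℂ)) := by
    intro n hn
    rw [mem_range] at hn
    have hs := two_mul_le_sin_pi_mul hδ (hd1 n hn) (hd2 n hn)
    have h1 := one_sub_e_mul_cot (d n) (by linarith)
    have h2 : e (x (n + 1)) = e (x n) * e (d n) := by
      have : x (n + 1) = x n + d n + k := by simp only [hd]; ring
      have h3 : e (x (n + 1)) = e (x (n + 1)) * e (-(k : ℝ)) := by rw [hk, mul_one]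
      rw [h3, ← e_add, ← e_add, this]
      congr 1
      ring
    rw [h2]
    linear_combination (-e (x n)) * h1
  have hanti : ∀ n < N, g (n + 1) ≤ g n := by
    intro n hn
    have hpi := Real.pi_pos
    refine Real.cot_le_cot_of_pos_of_lt_pi ?_ ?_ ?_
    · have := hd1 n (by omega); nlinarith
    · have := hmono n (by omega)
      exact mul_le_mul_of_nonneg_left (by simp only [hd]; linarith) hpi.le
    · have := hd2 (n + 1) (by omega); nlinarith
  have hB : ∀ n < N + 1, |g n| ≤ 1 / (2 * δ) := fun n hn =>
    abs_cot_pi_mul_le hδ (hd1 n hn) (hd2 n hn)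
  have habel := norm_sum_sub_mul_antitone_le (fun n => e (x n)) (fun n => (norm_e _).le) g N hanti
  set T := ∑ n ∈ range (N + 1), (e (x n) - e (x (n + 1))) * (g n : ℂ) with hT
  have hT' : ‖T‖ ≤ 4 * (1 / (2 * δ)) := by
    have h1 : ‖T‖ ≤ ‖T + e (x (N + 1)) * (g N : ℂ)‖ + ‖e (x (N + 1)) * (g N : ℂ)‖ := by
      simpa using norm_sub_le (T + e (x (N + 1)) * (g N : ℂ)) (e (x (N + 1)) * (g N : ℂ))
    have h2 : ‖e (x (N + 1)) * (g N : ℂ)‖ = |g N| := by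
      rw [norm_mul, norm_e, one_mul, Complex.norm_real, Real.norm_eq_abs]
    have h0 := hB 0 (by omega)
    have hN := hB N (by omega)
    linarith [le_abs_self (g 0), neg_abs_le (g N)]
  rw [sum_congr rfl hterm, sum_add_distrib, ← mul_sum, ← mul_sum, ← hT,
    sum_range_sub' (fun n => e (x n))]
  have h1 : ‖(1 / 2 : ℂ) * (e (x 0) - e (x (N + 1)))‖ ≤ 1 := by
    rw [norm_mul]
    have := norm_sub_le (e (x 0)) (e (x (N + 1)))
    rw [norm_e, norm_e] at this
    norm_num
    linarith
  have h2 : ‖Complex.I / 2 * T‖ ≤ 1 / δ := by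
    rw [norm_mul]
    have : 4 * (1 / (2 * δ)) = 2 * (1 / δ) := by field_simp; norm_num
    norm_num at *
    linarith
  have h3 : 1 ≤ 1 / δ := by
    rw [le_div_iff₀ hδ]
    linarith [hd1 0 (by omega), hd2 0 (by omega)]
  have h4 : 2 / δ = 1 / δ + 1 / δ := by ring
  linarith [norm_add_le ((1 / 2 : ℂ) * (e (x 0) - e (x (N + 1)))) (Complex.I / 2 * T)]

lemma Finset.eq_Icc_of_ordConnected {S : Finset ℕ} (hS : (S : Set ℕ).OrdConnected)
    (hne : S.Nonempty) : S = Icc (S.min' hne) (S.max' hne) := by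
  ext n
  refine ⟨fun h => mem_Icc.2 ⟨S.min'_le n h, S.le_max' n h⟩, fun h => ?_⟩
  rw [mem_Icc] at h
  exact mem_coe.1 (hS.out (mem_coe.2 (S.min'_mem hne)) (mem_coe.2 (S.max'_mem hne)) h)

lemma norm_sum_e_le_two_div (x : ℕ → ℝ) {S : Finset ℕ} (hS : (S : Set ℕ).OrdConnected)
    (k : ℤ) {δ : ℝ} (hδ : 0 < δ)
    (hlow : ∀ n ∈ S, k + δ ≤ x (n + 1) - x n) (hupp : ∀ n ∈ S, x (n + 1) - x n ≤ k + 1 - δ)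
    (hmono : ∀ i ∈ S, ∀ j ∈ S, i ≤ j → x (i + 1) - x i ≤ x (j + 1) - x j) :
    ‖∑ n ∈ S, e (x n)‖ ≤ 2 / δ := by
  rcases S.eq_empty_or_nonempty with rfl | hne
  · simp; positivity
  have hSI := Finset.eq_Icc_of_ordConnected hS hne
  set a := S.min' hne
  set b := S.max' hne
  have hmem : ∀ n < b + 1 - a, a + n ∈ S := fun n hn => by
    rw [hSI, mem_Icc]; omega
  rw [hSI, ← Finset.Ico_add_one_right_eq_Icc, sum_Ico_eq_sum_range]
  refine norm_sum_range_e_le_two_div (fun n => x (a + n)) _ k hδ ?_ ?_ ?_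
  · exact fun n hn => hlow _ (hmem n hn)
  · exact fun n hn => hupp _ (hmem n hn)
  · exact fun n hn => hmono _ (hmem n (by omega)) _ (hmem (n + 1) hn)
      (Nat.add_le_add_left (Nat.le_succ n) a)

lemma card_le_of_gap {S : Finset ℕ} {d : ℕ → ℝ} {μ y w : ℝ} (hμ : 0 < μ) (hw : 0 ≤ w)
    (hgap : ∀ i ∈ S, ∀ j ∈ S, i ≤ j → μ * ((j : ℝ) - i) ≤ d j - d i)
    (hlow : ∀ n ∈ S, y ≤ d n) (hupp : ∀ n ∈ S, d n ≤ y + w) : (#S : ℝ) ≤ w / μ + 1 := by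
  rcases S.eq_empty_or_nonempty with rfl | hne
  · simp; positivity
  have ha := S.min'_mem hne
  have hb := S.max'_mem hne
  have hab := S.min'_le _ hb
  have hsub : S ⊆ Icc (S.min' hne) (S.max' hne) :=
    fun n h => mem_Icc.2 ⟨S.min'_le n h, S.le_max' n h⟩
  have hcard := card_le_card hsub
  rw [Nat.card_Icc] at hcard
  have hcard' : (#S : ℝ) ≤ (S.max' hne : ℝ) + 1 - S.min' hne := by
    have : #S + S.min' hne ≤ S.max' hne + 1 := by omega
    have : (#S : ℝ) + S.min' hne ≤ S.max' hne + 1 := by exact_mod_cast this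
    linarith
  have h1 := hgap _ ha _ hb hab
  have h2 : (S.max' hne : ℝ) - S.min' hne ≤ w / μ := by
    rw [le_div_iff₀ hμ]
    linarith [hlow _ ha, hupp _ hb]
  linarith

/-- The contribution of a block of terms whose phase increments have the same integer part. -/
lemma norm_sum_e_le_of_floor_eq (x : ℕ → ℝ) {S : Finset ℕ} (hS : (S : Set ℕ).OrdConnected)
    {s : ℝ} (hs : 0 < s) (hs2 : s ≤ 1 / 2) (k : ℤ)
    (hgap : ∀ i ∈ S, ∀ j ∈ S, i ≤ j →
      s ^ 2 * ((j : ℝ) - i) ≤ (x (j + 1) - x j) - (x (i + 1) - x i))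
    (hfloor : ∀ n ∈ S, ⌊x (n + 1) - x n⌋ = k) :
    ‖∑ n ∈ S, e (x n)‖ ≤ 5 / s + 1 := by
  set d : ℕ → ℝ := fun n => x (n + 1) - x n with hd
  have hmono : ∀ i ∈ S, ∀ j ∈ S, i ≤ j → d i ≤ d j := by
    intro i hi j hj hij
    have h1 := hgap i hi j hj hij
    have h2 : (i : ℝ) ≤ j := by exact_mod_cast hij
    have h3 : 0 ≤ s ^ 2 * ((j : ℝ) - i) := mul_nonneg (sq_nonneg s) (by linarith)
    simp only [hd]
    linarith
  have hk : ∀ n ∈ S, (k : ℝ) ≤ d n ∧ d n < k + 1 := fun n hn => Int.floor_eq_iff.1 (hfloor n hn)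
  have hs' : s / s ^ 2 = 1 / s := by field_simp
  have htriv : ∀ A : Finset ℕ, ‖∑ n ∈ A, e (x n)‖ ≤ #A := fun A => by
    simpa [norm_e] using norm_sum_le A fun n => e (x n)
  set A := S.filter fun n => d n < k + s
  set B := S.filter fun n => ¬ d n < k + s
  set B₁ := B.filter fun n => d n ≤ k + 1 - s
  set B₂ := B.filter fun n => ¬ d n ≤ k + 1 - s
  have hA : ‖∑ n ∈ A, e (x n)‖ ≤ 1 / s + 1 := by
    refine (htriv A).trans ?_
    rw [← hs']
    refine card_le_of_gap (d := d) (y := k) (by positivity) hs.le ?_ ?_ ?_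
    · exact fun i hi j hj => hgap i (mem_filter.1 hi).1 j (mem_filter.1 hj).1
    · exact fun n hn => (hk n (mem_filter.1 hn).1).1
    · exact fun n hn => (mem_filter.1 hn).2.le
  have hB₂ : ‖∑ n ∈ B₂, e (x n)‖ ≤ 1 / s + 1 := by
    have hsub : ∀ n ∈ B₂, n ∈ S := fun n hn => (mem_filter.1 (mem_filter.1 hn).1).1
    refine (htriv B₂).trans ?_
    rw [← hs']
    refine card_le_of_gap (d := d) (y := k + 1 - s) (by positivity) hs.le ?_ ?_ ?_
    · exact fun i hi j hj => hgap i (hsub i hi) j (hsub j hj)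
    · exact fun n hn => (not_le.1 (mem_filter.1 hn).2).le
    · exact fun n hn => by linarith [(hk n (hsub n hn)).2]
  have hB₁ : ‖∑ n ∈ B₁, e (x n)‖ ≤ 2 / s := by
    have hsub : ∀ n ∈ B₁, n ∈ S := fun n hn => (mem_filter.1 (mem_filter.1 hn).1).1
    have hlow : ∀ n ∈ B₁, k + s ≤ d n := fun n hn =>
      not_lt.1 (mem_filter.1 (mem_filter.1 hn).1).2
    have hupp : ∀ n ∈ B₁, d n ≤ k + 1 - s := fun n hn => (mem_filter.1 hn).2
    refine norm_sum_e_le_two_div x ⟨?_⟩ k hs hlow hupp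
      fun i hi j hj => hmono i (hsub i hi) j (hsub j hj)
    intro i hi j hj n hn
    rw [mem_coe] at hi hj ⊢
    have hnS : n ∈ S := mem_coe.1 (hS.out (hsub i hi) (hsub j hj) hn)
    refine mem_filter.2 ⟨mem_filter.2 ⟨hnS, not_lt.2 ?_⟩, ?_⟩
    · exact (hlow i hi).trans (hmono i (hsub i hi) n hnS hn.1)
    · exact (hmono n hnS j (hsub j hj) hn.2).trans (hupp j hj)
  have hsplit : ∑ n ∈ S, e (x n)
      = ∑ n ∈ A, e (x n) + (∑ n ∈ B₁, e (x n) + ∑ n ∈ B₂, e (x n)) := by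
    rw [sum_filter_add_sum_filter_not B, sum_filter_add_sum_filter_not S]
  rw [hsplit]
  have h1 : 1 ≤ 1 / (2 * s) := by rw [le_div_iff₀ (by positivity)]; linarith
  have h2 : 1 / (2 * s) = 1 / 2 * (1 / s) := by field_simp
  have h3 : 2 / s = 2 * (1 / s) := by ring
  have h5 : 5 / s = 5 * (1 / s) := by ring
  linarith [norm_add_le (∑ n ∈ A, e (x n)) (∑ n ∈ B₁, e (x n) + ∑ n ∈ B₂, e (x n)),
    norm_add_le (∑ n ∈ B₁, e (x n)) (∑ n ∈ B₂, e (x n))]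

/-- Van der Corput's second derivative test, for second differences comparable to `s ^ 2`. -/
lemma norm_sum_e_le_of_second_difference (x : ℕ → ℝ) {S : Finset ℕ}
    (hS : (S : Set ℕ).OrdConnected) {s L : ℝ} (hs : 0 < s) (hL : (#S : ℝ) ≤ L)
    (hlow : ∀ i ∈ S, ∀ j ∈ S, i ≤ j →
      s ^ 2 * ((j : ℝ) - i) ≤ (x (j + 1) - x j) - (x (i + 1) - x i))
    (hupp : ∀ i ∈ S, ∀ j ∈ S, i ≤ j →
      (x (j + 1) - x j) - (x (i + 1) - x i) ≤ 16 * s ^ 2 * ((j : ℝ) - i)) :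
    ‖∑ n ∈ S, e (x n)‖ ≤ 96 * L * s + 12 / s := by
  have hL0 : 0 ≤ L := (Nat.cast_nonneg _).trans hL
  rcases S.eq_empty_or_nonempty with rfl | hne
  · simp; positivity
  rcases lt_or_ge (1 / 2) s with hs2 | hs2
  · have : ‖∑ n ∈ S, e (x n)‖ ≤ #S := by simpa [norm_e] using norm_sum_le S fun n => e (x n)
    have : 0 ≤ 12 / s := by positivity
    nlinarith
  set d : ℕ → ℝ := fun n => x (n + 1) - x n with hd
  have hmono : ∀ i ∈ S, ∀ j ∈ S, i ≤ j → d i ≤ d j := by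
    intro i hi j hj hij
    have h1 := hlow i hi j hj hij
    have h2 : (i : ℝ) ≤ j := by exact_mod_cast hij
    have h3 : 0 ≤ s ^ 2 * ((j : ℝ) - i) := mul_nonneg (sq_nonneg s) (by linarith)
    simp only [hd]
    linarith
  have ha := S.min'_mem hne
  have hb := S.max'_mem hne
  have hab := S.min'_le _ hb
  have hSI := Finset.eq_Icc_of_ordConnected hS hne
  set a := S.min' hne
  set b := S.max' hne
  have hlen : (b : ℝ) - a ≤ L := by
    have hcard : #S = b + 1 - a := by rw [hSI, Nat.card_Icc]
    have : (b : ℝ) ≤ #S + a := by exact_mod_cast (by omega : b ≤ #S + a)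
    linarith
  set I := Icc ⌊d a⌋ ⌊d b⌋
  have hmaps : ∀ n ∈ S, ⌊d n⌋ ∈ I := fun n hn => mem_Icc.2
    ⟨Int.floor_le_floor (hmono a ha n hn (S.min'_le n hn)),
      Int.floor_le_floor (hmono n hn b hb (S.le_max' n hn))⟩
  have hI : (#I : ℝ) ≤ 16 * s ^ 2 * L + 2 := by
    have hle : ⌊d a⌋ ≤ ⌊d b⌋ := Int.floor_le_floor (hmono a ha b hb hab)
    have hcard : (#I : ℝ) = ⌊d b⌋ + 1 - ⌊d a⌋ := by
      have : (#I : ℤ) = ⌊d b⌋ + 1 - ⌊d a⌋ := by rw [Int.card_Icc]; omega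
      exact_mod_cast this
    have h1 := hupp a ha b hb hab
    have h2 : 16 * s ^ 2 * ((b : ℝ) - a) ≤ 16 * s ^ 2 * L :=
      mul_le_mul_of_nonneg_left hlen (by positivity)
    have h3 := Int.floor_le (d b)
    have h4 := Int.lt_floor_add_one (d a)
    simp only [hd] at h3 h4 hcard
    linarith
  have hblock : ∀ k ∈ I, ‖∑ n ∈ S with ⌊d n⌋ = k, e (x n)‖ ≤ 5 / s + 1 := by
    intro k _
    refine norm_sum_e_le_of_floor_eq x ⟨?_⟩ hs hs2 k ?_ fun n hn => (mem_filter.1 hn).2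
    · intro i hi j hj n hn
      rw [mem_coe, mem_filter] at hi hj
      have hnS : n ∈ S := mem_coe.1 (hS.out hi.1 hj.1 hn)
      rw [mem_coe, mem_filter]
      refine ⟨hnS, le_antisymm ?_ ?_⟩
      · exact hj.2 ▸ Int.floor_le_floor (hmono n hnS j hj.1 hn.2)
      · exact hi.2 ▸ Int.floor_le_floor (hmono i hi.1 n hnS hn.1)
    · exact fun i hi j hj => hlow i (mem_filter.1 hi).1 j (mem_filter.1 hj).1
  rw [← sum_fiberwise_of_maps_to hmaps]
  calc ‖∑ k ∈ I, ∑ n ∈ S with ⌊d n⌋ = k, e (x n)‖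
      ≤ ∑ k ∈ I, (5 / s + 1) := (norm_sum_le _ _).trans (sum_le_sum hblock)
    _ = #I * (5 / s + 1) := by rw [sum_const, nsmul_eq_mul]
    _ ≤ (16 * s ^ 2 * L + 2) * (6 / s) := by
        have h1 : 1 ≤ 1 / s := by rw [le_div_iff₀ hs]; linarith
        have h2 : 5 / s + 1 ≤ 6 / s := by
          have : 6 / s = 5 / s + 1 / s := by ring
          linarith
        gcongr
    _ = 96 * L * s + 12 / s := by field_simp; ring

lemma mul_sub_le_sub_and_sub_le_mul_sub {f f' : ℝ → ℝ} {a b lo hi : ℝ} (hab : a ≤ b)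
    (hf : ∀ t ∈ Set.Icc a b, HasDerivAt f (f' t) t) (hlo : ∀ t ∈ Set.Icc a b, lo ≤ f' t)
    (hhi : ∀ t ∈ Set.Icc a b, f' t ≤ hi) :
    lo * (b - a) ≤ f b - f a ∧ f b - f a ≤ hi * (b - a) := by
  rcases hab.eq_or_lt with rfl | hlt
  · simp
  obtain ⟨t, ht, hft⟩ := exists_hasDerivAt_eq_slope f f' hlt
    (fun t ht => (hf t ht).continuousAt.continuousWithinAt)
    fun t ht => hf t (Set.Ioo_subset_Icc_self ht)
  have hpos : 0 < b - a := by linarith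
  rw [eq_div_iff hpos.ne'] at hft
  rw [← hft]
  exact ⟨mul_le_mul_of_nonneg_right (hlo t (Set.Ioo_subset_Icc_self ht)) hpos.le,
    mul_le_mul_of_nonneg_right (hhi t (Set.Ioo_subset_Icc_self ht)) hpos.le⟩

lemma rpow_second_difference_bounds {γ a b Z W : ℝ} (hγ0 : 0 < γ) (hγ1 : γ < 1) (hZ : 0 < Z)
    (hZa : Z ≤ a) (hab : a ≤ b) (hbW : b + 1 ≤ W) :
    γ * (1 - γ) * W ^ (γ - 2) * (b - a) ≤ (b ^ γ - (b + 1) ^ γ) - (a ^ γ - (a + 1) ^ γ) ∧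
    (b ^ γ - (b + 1) ^ γ) - (a ^ γ - (a + 1) ^ γ) ≤ γ * (1 - γ) * Z ^ (γ - 2) * (b - a) := by
  have hfirst : ∀ t, Z ≤ t → t + 1 ≤ W → (1 - γ) * W ^ (γ - 2) ≤ t ^ (γ - 1) - (t + 1) ^ (γ - 1) ∧
      t ^ (γ - 1) - (t + 1) ^ (γ - 1) ≤ (1 - γ) * Z ^ (γ - 2) := by
    intro t ht htW
    have h := mul_sub_le_sub_and_sub_le_mul_sub (f := fun u => -u ^ (γ - 1))
      (f' := fun u => (1 - γ) * u ^ (γ - 2)) (a := t) (b := t + 1)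
      (lo := (1 - γ) * W ^ (γ - 2)) (hi := (1 - γ) * Z ^ (γ - 2)) (by linarith) ?_ ?_ ?_
    · simp only [add_sub_cancel_left, mul_one] at h
      constructor <;> linarith [h.1, h.2]
    · intro u hu
      have h1 := (Real.hasDerivAt_rpow_const (x := u) (p := γ - 1)
        (Or.inl (by linarith [hu.1] : 0 < u).ne')).neg
      refine h1.congr_deriv ?_
      rw [show γ - 1 - 1 = γ - 2 by ring]
      ring
    · intro u hu
      exact mul_le_mul_of_nonneg_left (Real.rpow_le_rpow_of_nonpos (by linarith [hu.1])
        (by linarith [hu.2]) (by linarith)) (by linarith)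
    · intro u hu
      exact mul_le_mul_of_nonneg_left (Real.rpow_le_rpow_of_nonpos hZ
        (by linarith [hu.1]) (by linarith)) (by linarith)
  refine mul_sub_le_sub_and_sub_le_mul_sub (f := fun t => t ^ γ - (t + 1) ^ γ)
    (f' := fun t => γ * (t ^ (γ - 1) - (t + 1) ^ (γ - 1))) hab ?_ ?_ ?_
  · intro t ht
    have ht0 : 0 < t := by linarith [ht.1]
    have h1 := Real.hasDerivAt_rpow_const (x := t) (p := γ) (Or.inl ht0.ne')
    have h2 := (Real.hasDerivAt_rpow_const (x := t + 1) (p := γ)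
      (Or.inl (by linarith : 0 < t + 1).ne')).comp_add_const t 1
    exact (h1.sub h2).congr_deriv (by ring)
  · intro t ht
    rw [mul_assoc]
    exact mul_le_mul_of_nonneg_left
      (hfirst t (by linarith [ht.1]) (by linarith [ht.2])).1 hγ0.le
  · intro t ht
    rw [mul_assoc]
    exact mul_le_mul_of_nonneg_left
      (hfirst t (by linarith [ht.1]) (by linarith [ht.2])).2 hγ0.le

/-- The exponential sum over `n` with phase `β n - h (m n) ^ γ`, over an interval on which
`m n` has size `X`. -/
lemma norm_sum_e_linear_sub_rpow_le {γ h X β : ℝ} (hγ0 : 0 < γ) (hγ1 : γ < 1) (hh : 1 ≤ h)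
    {m : ℕ} {S : Finset ℕ} (hS : (S : Set ℕ).OrdConnected)
    (hX : ∀ n ∈ S, X / 2 ≤ (m : ℝ) * n ∧ (m : ℝ) * n < X) (hX0 : 0 < X) (hm : 0 < m) :
    ‖∑ n ∈ S, e (β * n - h * ((m : ℝ) * n) ^ γ)‖
      ≤ 96 * √(γ * (1 - γ) * 2 ^ (γ - 2)) * √h * X ^ (γ / 2)
        + 12 / √(γ * (1 - γ) * 2 ^ (γ - 2)) * X ^ (1 - γ / 2) / m := by
  set K := √(γ * (1 - γ) * 2 ^ (γ - 2)) with hK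
  have hκ : 0 < γ * (1 - γ) * (2 : ℝ) ^ (γ - 2) :=
    mul_pos (mul_pos hγ0 (by linarith)) (by positivity)
  have hK0 : 0 < K := Real.sqrt_pos.2 hκ
  have hm0 : (0 : ℝ) < m := by exact_mod_cast hm
  have hh0 : 0 < h := by linarith
  have hsh : 1 ≤ √h := Real.one_le_sqrt.2 hh
  set s := K * √h * m * X ^ (γ / 2 - 1) with hs
  have hs0 : 0 < s := by positivity
  set Y := X / m with hY
  have hY0 : 0 < Y := by positivity
  have hmY : (m : ℝ) ^ γ * Y ^ (γ - 2) = m ^ 2 * X ^ (γ - 2) := by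
    rw [hY, Real.div_rpow hX0.le hm0.le]
    have : (m : ℝ) ^ γ = m ^ (γ - 2) * m ^ 2 := by
      rw [← Real.rpow_natCast, ← Real.rpow_add hm0]; norm_num
    rw [this]
    field_simp
  have hssq : s ^ 2 = h * m ^ γ * (γ * (1 - γ) * (2 * Y) ^ (γ - 2)) := by
    have h1 : (X ^ (γ / 2 - 1)) ^ 2 = X ^ (γ - 2) := by
      rw [← Real.rpow_natCast, ← Real.rpow_mul hX0.le]; congr 1; push_cast; ring
    rw [hs, mul_pow, mul_pow, mul_pow, h1, hK, Real.sq_sqrt hκ.le, Real.sq_sqrt hh0.le,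
      Real.mul_rpow (by norm_num) hY0.le]
    linear_combination (-(γ * (1 - γ) * 2 ^ (γ - 2) * h)) * hmY
  have hSY : ∀ n ∈ S, Y / 2 ≤ (n : ℝ) ∧ (n : ℝ) < Y := by
    intro n hn
    obtain ⟨h1, h2⟩ := hX n hn
    have h3 : Y * m = X := div_mul_cancel₀ _ hm0.ne'
    constructor <;> nlinarith
  have hSpos : ∀ n ∈ S, 1 ≤ n := by
    intro n hn
    have : (0 : ℝ) < n := by linarith [(hSY n hn).1]
    exact_mod_cast this
  have hcard : (#S : ℝ) ≤ Y := by
    have hsub : S ⊆ Icc 1 ⌊Y⌋₊ := fun n hn =>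
      mem_Icc.2 ⟨hSpos n hn, Nat.le_floor (hSY n hn).2.le⟩
    have := card_le_card hsub
    rw [Nat.card_Icc, Nat.add_sub_cancel] at this
    exact (Nat.cast_le.2 this).trans (Nat.floor_le hY0.le)
  have hdiff : ∀ i ∈ S, ∀ j ∈ S, i ≤ j →
      s ^ 2 * ((j : ℝ) - i) ≤ h * m ^ γ * (((j : ℝ) ^ γ - ((j : ℝ) + 1) ^ γ)
        - ((i : ℝ) ^ γ - ((i : ℝ) + 1) ^ γ)) ∧
      h * m ^ γ * (((j : ℝ) ^ γ - ((j : ℝ) + 1) ^ γ) - ((i : ℝ) ^ γ - ((i : ℝ) + 1) ^ γ))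
        ≤ 16 * s ^ 2 * ((j : ℝ) - i) := by
    intro i hi j hj hij
    have hij' : (i : ℝ) ≤ j := by exact_mod_cast hij
    have h1j : (1 : ℝ) ≤ j := by exact_mod_cast hSpos j hj
    obtain ⟨h1, h2⟩ := rpow_second_difference_bounds (Z := Y / 2) (W := 2 * Y) hγ0 hγ1
      (by linarith) (hSY i hi).1 hij' (by linarith [(hSY j hj).2])
    have hc : 0 < h * (m : ℝ) ^ γ := by positivity
    constructor
    · rw [hssq, mul_assoc (h * (m : ℝ) ^ γ)]
      exact mul_le_mul_of_nonneg_left h1 hc.le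
    · have h16 : (Y / 2) ^ (γ - 2) ≤ 16 * (2 * Y) ^ (γ - 2) := by
        have h3 : Y / 2 = (2 * Y) * (1 / 4) := by ring
        have h4 : ((1 : ℝ) / 4) ^ (γ - 2) ≤ 16 := by
          have := Real.rpow_le_rpow_of_exponent_ge (x := (1 : ℝ) / 4) (by norm_num) (by norm_num)
            (show (-2 : ℝ) ≤ γ - 2 by linarith)
          have h5 : ((1 : ℝ) / 4) ^ (-2 : ℝ) = 16 := by
            rw [Real.rpow_neg (by norm_num)]; norm_num
          linarith
        rw [h3, Real.mul_rpow (by positivity) (by norm_num), mul_comm]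
        gcongr
      have h6 : γ * (1 - γ) * (Y / 2) ^ (γ - 2) * ((j : ℝ) - i)
          ≤ γ * (1 - γ) * (16 * (2 * Y) ^ (γ - 2)) * ((j : ℝ) - i) := by
        have : 0 ≤ (j : ℝ) - i := by linarith
        have : 0 < γ * (1 - γ) := mul_pos hγ0 (by linarith)
        gcongr
      calc _ ≤ h * (m : ℝ) ^ γ * (γ * (1 - γ) * (16 * (2 * Y) ^ (γ - 2)) * ((j : ℝ) - i)) :=
            mul_le_mul_of_nonneg_left (h2.trans h6) hc.le
        _ = _ := by rw [hssq]; ring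
  have hx : ∀ i : ℕ, ((β * (i + 1 : ℕ) - h * ((m : ℝ) * (i + 1 : ℕ)) ^ γ)
      - (β * i - h * ((m : ℝ) * i) ^ γ))
      = β + h * m ^ γ * ((i : ℝ) ^ γ - ((i : ℝ) + 1) ^ γ) := by
    intro i
    rw [Real.mul_rpow hm0.le (by positivity), Real.mul_rpow hm0.le (by positivity)]
    push_cast
    ring
  have hmain := norm_sum_e_le_of_second_difference
    (fun n : ℕ => β * n - h * ((m : ℝ) * n) ^ γ) hS hs0 hcard ?_ ?_
  · refine hmain.trans (add_le_add (le_of_eq ?_) ?_)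
    · have h1 : X ^ (γ / 2) = X * X ^ (γ / 2 - 1) := by
        rw [Real.rpow_sub_one hX0.ne']; field_simp
      rw [hs, hY, h1]
      field_simp
    · have h1 : X ^ (1 - γ / 2) = (X ^ (γ / 2 - 1))⁻¹ := by
        rw [← Real.rpow_neg hX0.le]; congr 1; ring
      have h2 : K * m * X ^ (γ / 2 - 1) ≤ s := by
        have : s = √h * (K * m * X ^ (γ / 2 - 1)) := by rw [hs]; ring
        rw [this]
        exact le_mul_of_one_le_left (by positivity) hsh
      calc 12 / s ≤ 12 / (K * m * X ^ (γ / 2 - 1)) := by gcongr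
        _ = _ := by rw [h1]; field_simp
  · intro i hi j hj hij
    rw [hx, hx]
    linarith [(hdiff i hi j hj hij).1]
  · intro i hi j hj hij
    rw [hx, hx]
    linarith [(hdiff i hi j hj hij).2]

lemma norm_sum_e_linear_add_rpow_le {γ h X β : ℝ} (hγ0 : 0 < γ) (hγ1 : γ < 1) (hh : 1 ≤ |h|)
    {m : ℕ} {S : Finset ℕ} (hS : (S : Set ℕ).OrdConnected)
    (hX : ∀ n ∈ S, X / 2 ≤ (m : ℝ) * n ∧ (m : ℝ) * n < X) (hX0 : 0 < X) (hm : 0 < m) :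
    ‖∑ n ∈ S, e (β * n + h * ((m : ℝ) * n) ^ γ)‖
      ≤ 96 * √(γ * (1 - γ) * 2 ^ (γ - 2)) * √|h| * X ^ (γ / 2)
        + 12 / √(γ * (1 - γ) * 2 ^ (γ - 2)) * X ^ (1 - γ / 2) / m := by
  rcases le_total h 0 with h0 | h0
  · have := norm_sum_e_linear_sub_rpow_le (β := β) hγ0 hγ1 hh hS hX hX0 hm
    rw [abs_of_nonpos h0] at this ⊢
    simpa only [neg_mul, sub_neg_eq_add] using this
  · have := norm_sum_e_linear_sub_rpow_le (β := -β) hγ0 hγ1 hh hS hX hX0 hm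
    rw [abs_of_nonneg h0] at this ⊢
    rw [← norm_sum_e_neg]
    simpa only [neg_add, neg_mul, ← sub_eq_add_neg] using this

lemma card_dyN_le {Y : ℝ} (hY : 0 < Y) : (#(dyN Y) : ℝ) ≤ Y := by
  have hsub : dyN Y ⊆ Icc 1 ⌊Y⌋₊ := by
    intro n hn
    obtain ⟨-, h1, h2⟩ := mem_filter.1 hn
    have : (0 : ℝ) < n := by linarith
    exact mem_Icc.2 ⟨by exact_mod_cast this, Nat.le_floor h2.le⟩
  have := card_le_card hsub
  rw [Nat.card_Icc, Nat.add_sub_cancel] at this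
  exact (Nat.cast_le.2 this).trans (Nat.floor_le hY.le)

lemma card_dyZ_le {Y : ℝ} (hY : 0 < Y) : (#(dyZ Y) : ℝ) ≤ 2 * Y := by
  have hsub : dyZ Y ⊆ (Icc 1 ⌊Y⌋₊).image (fun n : ℕ => (n : ℤ))
      ∪ (Icc 1 ⌊Y⌋₊).image (fun n : ℕ => -(n : ℤ)) := by
    intro l hl
    obtain ⟨-, h0, -, h2⟩ := mem_filter.1 hl
    have h3 : ((l.natAbs : ℕ) : ℝ) < Y := by
      rwa [← Int.cast_natCast, Int.natCast_natAbs, Int.cast_abs]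
    have hmem : l.natAbs ∈ Icc 1 ⌊Y⌋₊ :=
      mem_Icc.2 ⟨Int.natAbs_pos.2 h0, Nat.le_floor h3.le⟩
    rcases Int.natAbs_eq l with h | h
    · exact mem_union_left _ (mem_image.2 ⟨_, hmem, h.symm⟩)
    · exact mem_union_right _ (mem_image.2 ⟨_, hmem, h.symm⟩)
  have hcard : #(dyZ Y) ≤ ⌊Y⌋₊ + ⌊Y⌋₊ := by
    refine (card_le_card hsub).trans ((card_union_le _ _).trans (add_le_add ?_ ?_)) <;>
    · refine card_image_le.trans ?_
      simp
  have h1 : (#(dyZ Y) : ℝ) ≤ ⌊Y⌋₊ + ⌊Y⌋₊ := by exact_mod_cast hcard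
  linarith [Nat.floor_le hY.le]

lemma norm_weighted_sum_le {ι κ μ ν : Type*} (A : Finset ι) (F : ι → Finset κ) (P : Finset μ)
    (Q : Finset ν) (a : ι → ℂ) (c : μ → ℂ) (d : ν → ℂ) (E : ι → κ → μ → ν → ℂ)
    (ha : ∀ m ∈ A, ‖a m‖ ≤ 1) (hc : ∀ l ∈ P, ‖c l‖ ≤ 1) (hd : ∀ h ∈ Q, ‖d h‖ ≤ 1) {B : ℝ}
    (hE : ∀ m ∈ A, ∀ l ∈ P, ∀ h ∈ Q, ‖∑ n ∈ F m, E m n l h‖ ≤ B) :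
    ‖∑ m ∈ A, ∑ n ∈ F m, ∑ l ∈ P, ∑ h ∈ Q, a m * c l * d h * E m n l h‖
      ≤ #A * (#P * (#Q * B)) := by
  rw [← nsmul_eq_mul, ← nsmul_eq_mul, ← nsmul_eq_mul]
  refine (norm_sum_le _ _).trans (sum_le_card_nsmul _ _ _ fun m hm => ?_)
  rw [sum_comm]
  refine (norm_sum_le _ _).trans (sum_le_card_nsmul _ _ _ fun l hl => ?_)
  rw [sum_comm]
  refine (norm_sum_le _ _).trans (sum_le_card_nsmul _ _ _ fun h hh => ?_)
  rw [← mul_sum, norm_mul, norm_mul, norm_mul]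
  have h1 : ‖a m‖ * ‖c l‖ * ‖d h‖ ≤ 1 :=
    mul_le_one₀ (mul_le_one₀ (ha m hm) (norm_nonneg _) (hc l hl)) (norm_nonneg _) (hd h hh)
  exact (mul_le_of_le_one_left (norm_nonneg _) h1).trans (hE m hm l hl h hh)

theorem S3_small (c γ θ : ℝ) (hc1 : 1 < c) (hc2 : c < 9/8) (hγ : γ = 1/c)
    (hθ1 : 0 < θ) (hθ2 : θ < (9*γ - 8)/10) :
    ∃ η > (0:ℝ), ∃ C > (0:ℝ), ∃ X₀ > (0:ℝ), ∀ X : ℕ, X₀ ≤ (X:ℝ) → ∀ α : ℝ,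
    ∀ M N U V : ℝ, 1 ≤ M → 1 ≤ N → 1 ≤ U → 1 ≤ V →
    M ≤ (X:ℝ)^(γ-1/2-θ-5*η) → U ≤ (⌊(X:ℝ)^(θ+η)⌋₊ : ℝ) → V ≤ (⌊10 * (X:ℝ)^(1-γ+η) / γ⌋₊ : ℝ) →
    ∀ am : ℕ → ℂ, ∀ cl dh : ℤ → ℂ,
    (∀ m ∈ dyN M, ‖am m‖ ≤ 1) →
    (∀ l ∈ dyZ U, ‖cl l‖ ≤ 1) → (∀ h ∈ dyZ V, ‖dh h‖ ≤ 1) →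
    ‖∑ m ∈ dyN M, ∑ n ∈ (dyN N).filter (fun n => (X:ℝ)/2 ≤ ((m*n:ℕ):ℝ) ∧ ((m*n:ℕ):ℝ) < (X:ℝ)),
        ∑ l ∈ dyZ U, ∑ h ∈ dyZ V, am m * cl l * dh h *
          e (α * (l:ℝ) * (m:ℝ) * (n:ℝ) + (h:ℝ) * ((m:ℝ)*(n:ℝ))^γ)‖ ≤ C * (X:ℝ)^(1-2*η) := by
  have hc0 : 0 < c := by linarith
  have hγ0 : 0 < γ := by rw [hγ]; positivity
  have hγ1 : γ < 1 := by rw [hγ, div_lt_one hc0]; exact hc1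
  have hγ8 : 8 / 9 < γ := by rw [hγ, lt_div_iff₀ hc0]; linarith
  set K := √(γ * (1 - γ) * 2 ^ (γ - 2)) with hK
  have hK0 : 0 < K :=
    Real.sqrt_pos.2 (mul_pos (mul_pos hγ0 (by linarith)) (by positivity))
  set D := 10 / γ with hD
  have hD0 : 0 < D := by positivity
  refine ⟨1 / 100, by norm_num, 4 * D * (96 * K * √D) + 4 * D * (24 / K), by positivity, 1,
    one_pos, ?_⟩
  intro X hX α M N U V hM1 hN1 hU1 hV1 hM hU hV am cl dh ham hcl hdh
  have hX0 : (0 : ℝ) < X := by linarith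
  set x : ℝ := (X : ℝ) with hx
  set p := x ^ (1 - γ + 1 / 100) with hp
  set u := x ^ (θ + 1 / 100) with hu
  have hp0 : 0 < p := by positivity
  have hu0 : 0 < u := by positivity
  have hU' : U ≤ u := hU.trans (Nat.floor_le hu0.le)
  have hV' : V ≤ D * p := by
    refine hV.trans ((Nat.floor_le (by positivity)).trans (le_of_eq ?_))
    rw [hD]
    ring
  set B := 96 * K * √(D * p) * x ^ (γ / 2) + 24 / K * x ^ (1 - γ / 2) / M with hB
  have hB0 : 0 < B := by positivity
  have hE : ∀ m ∈ dyN M, ∀ l ∈ dyZ U, ∀ h ∈ dyZ V,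
      ‖∑ n ∈ (dyN N).filter (fun n => x / 2 ≤ ((m * n : ℕ) : ℝ) ∧ ((m * n : ℕ) : ℝ) < x),
        e (α * (l : ℝ) * (m : ℝ) * (n : ℝ) + (h : ℝ) * ((m : ℝ) * (n : ℝ)) ^ γ)‖ ≤ B := by
    intro m hm l _ h hh
    obtain ⟨-, hmM, -⟩ := mem_filter.1 hm
    obtain ⟨-, hh0, -, hhV⟩ := mem_filter.1 hh
    have hm0 : (0 : ℝ) < m := by linarith
    have hh1 : (1 : ℝ) ≤ |(h : ℝ)| := by exact_mod_cast Int.one_le_abs hh0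
    refine (norm_sum_e_linear_add_rpow_le (X := x) hγ0 hγ1 hh1 ⟨?_⟩ ?_ hX0
      (by exact_mod_cast hm0)).trans ?_
    · intro i hi j hj n hn
      simp only [dyN, mem_coe, mem_filter, mem_range] at hi hj ⊢
      have h1 : (i : ℝ) ≤ n := by exact_mod_cast hn.1
      have h2 : (n : ℝ) ≤ j := by exact_mod_cast hn.2
      have h3 : ((m * i : ℕ) : ℝ) ≤ ((m * n : ℕ) : ℝ) :=
        Nat.cast_le.2 (Nat.mul_le_mul_left m hn.1)
      have h4 : ((m * n : ℕ) : ℝ) ≤ ((m * j : ℕ) : ℝ) :=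
        Nat.cast_le.2 (Nat.mul_le_mul_left m hn.2)
      exact ⟨⟨hn.2.trans_lt hj.1.1, hi.1.2.1.trans h1, h2.trans_lt hj.1.2.2⟩,
        hi.2.1.trans h3, h4.trans_lt hj.2.2⟩
    · intro n hn
      have := (mem_filter.1 hn).2
      push_cast at this
      exact this
    · have h1 : |(h : ℝ)| ≤ D * p := hhV.le.trans hV'
      have h2 : 12 / K * x ^ (1 - γ / 2) / m ≤ 24 / K * x ^ (1 - γ / 2) / M := by
        have : 24 / K * x ^ (1 - γ / 2) / M = 12 / K * x ^ (1 - γ / 2) / (M / 2) := by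
          field_simp; norm_num
        rw [this]
        gcongr
      exact add_le_add (by gcongr) h2
  refine (norm_weighted_sum_le (dyN M) _ (dyZ U) (dyZ V) am cl dh
    (fun (m n : ℕ) (l h : ℤ) => e (α * (l : ℝ) * (m : ℝ) * (n : ℝ) + (h : ℝ) * ((m : ℝ) * (n : ℝ)) ^ γ))
    ham hcl hdh hE).trans ?_
  have hA := card_dyN_le (by linarith : 0 < M)
  have hP := (card_dyZ_le (by linarith : 0 < U)).trans (mul_le_mul_of_nonneg_left hU' two_pos.le)
  have hQ := (card_dyZ_le (by linarith : 0 < V)).trans (mul_le_mul_of_nonneg_left hV' two_pos.le)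
  have hfirst : x ^ (γ - 1 / 2 - θ - 5 * (1 / 100)) * u * p * √p * x ^ (γ / 2)
      ≤ x ^ (1 - 2 * (1 / 100) : ℝ) := by
    rw [Real.sqrt_eq_rpow, hp, hu, ← Real.rpow_mul hX0.le, ← Real.rpow_add hX0,
      ← Real.rpow_add hX0, ← Real.rpow_add hX0, ← Real.rpow_add hX0]
    exact Real.rpow_le_rpow_of_exponent_le hX (by linarith)
  have hsecond : u * p * x ^ (1 - γ / 2) ≤ x ^ (1 - 2 * (1 / 100) : ℝ) := by
    rw [hp, hu, ← Real.rpow_add hX0, ← Real.rpow_add hX0]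
    exact Real.rpow_le_rpow_of_exponent_le hX (by linarith)
  calc (#(dyN M) : ℝ) * (#(dyZ U) * (#(dyZ V) * B))
      ≤ M * (2 * u * (2 * (D * p) * B)) := by gcongr
    _ = 4 * D * (96 * K * √D) * (M * u * p * √p * x ^ (γ / 2))
        + 4 * D * (24 / K) * (u * p * x ^ (1 - γ / 2)) := by
      rw [hB, Real.sqrt_mul hD0.le]
      field_simp
      ring
    _ ≤ 4 * D * (96 * K * √D) * (x ^ (γ - 1 / 2 - θ - 5 * (1 / 100)) * u * p * √p * x ^ (γ / 2))
        + 4 * D * (24 / K) * (u * p * x ^ (1 - γ / 2)) := by gcongr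
    _ ≤ 4 * D * (96 * K * √D) * x ^ (1 - 2 * (1 / 100) : ℝ)
        + 4 * D * (24 / K) * x ^ (1 - 2 * (1 / 100) : ℝ) := by gcongr
    _ = _ := by ring
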